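/- Let ρ : ℝ³ × ℝ → ℝ be C¹. If for every open set V ⊆ U the function t ↦ ∫_{x̂(V × {t})} ρ(x,t) dH²(x) has vanishing derivative at every t ∈ (0,T), then the continuity equation holds pointwise: (D_t ρ + (div_Γ v) ρ)(x̂(X,t), t) = 0 for every X ∈ U and every t ∈ (0,T). -/

import Mathlib

noncomputable section
open MeasureTheory

/-- ℝ² with the Euclidean structure. -/
abbrev E2 : Type := EuclideanSpace ℝ (Fin 2)
/-- ℝ³ with the Euclidean structure. -/
abbrev E3 : Type := EuclideanSpace ℝ (Fin 3)

/-- The cross product on ℝ³. -/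
def cross3 (a b : E3) : E3 :=
  (EuclideanSpace.equiv (Fin 3) ℝ).symm
    ![a 1 * b 2 - a 2 * b 1, a 2 * b 0 - a 0 * b 2, a 0 * b 1 - a 1 * b 0]

/-- The dot product on ℝ³. -/
def dot3 (a b : E3) : ℝ := ∑ i, a i * b i

/-- The tangent vector `g_α = ∂x̂/∂X_α` of the parametrization `x̂` at `(X, t)`. -/
def gVec (xh : E2 × ℝ → E3) (α : Fin 2) (X : E2) (t : ℝ) : E3 :=
  fderiv ℝ (fun Y : E2 => xh (Y, t)) X (EuclideanSpace.single α 1)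

/-- The Riemannian metric `g_{αβ} = g_α · g_β`. -/
def gMet (xh : E2 × ℝ → E3) (α β : Fin 2) (X : E2) (t : ℝ) : ℝ :=
  dot3 (gVec xh α X t) (gVec xh β X t)

/-- The Gram determinant `G = g₁₁ g₂₂ − g₁₂ g₂₁`. -/
def Gdet (xh : E2 × ℝ → E3) (X : E2) (t : ℝ) : ℝ :=
  gMet xh 0 0 X t * gMet xh 1 1 X t - gMet xh 0 1 X t * gMet xh 1 0 X t

/-- The inverse metric `(g^{αβ}) = (g_{αβ})⁻¹`. -/
def gInv (xh : E2 × ℝ → E3) (X : E2) (t : ℝ) : Matrix (Fin 2) (Fin 2) ℝ :=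
  (Matrix.of fun α β => gMet xh α β X t)⁻¹

/-- The raised tangent vector `g^α = Σ_β g^{αβ} g_β`. -/
def gVecUp (xh : E2 × ℝ → E3) (α : Fin 2) (X : E2) (t : ℝ) : E3 :=
  ∑ β, gInv xh X t α β • gVec xh β X t

/-- The unit normal `n̂ = (g₁ × g₂)/|g₁ × g₂|` of the parametrized surface. -/
def nHat (xh : E2 × ℝ → E3) (X : E2) (t : ℝ) : E3 :=
  ‖cross3 (gVec xh 0 X t) (gVec xh 1 X t)‖⁻¹ • cross3 (gVec xh 0 X t) (gVec xh 1 X t)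

/-- Spatial partial derivative `∂f/∂x_j` at `(x, t)`. -/
def pdx (j : Fin 3) (f : E3 × ℝ → ℝ) (x : E3) (t : ℝ) : ℝ :=
  fderiv ℝ (fun y : E3 => f (y, t)) x (EuclideanSpace.single j 1)

/-- Time partial derivative `∂f/∂t` at `(x, t)`. -/
def pdt (f : E3 × ℝ → ℝ) (x : E3) (t : ℝ) : ℝ := deriv (fun s => f (x, s)) t

/-- Tangential derivative `∂_j^Γ f = Σ_i (δ_{ij} − N_i N_j) ∂f/∂x_i`
with normal extension `N`. -/
def tder (N : E3 × ℝ → E3) (j : Fin 3) (f : E3 × ℝ → ℝ) (x : E3) (t : ℝ) : ℝ :=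
  ∑ i, ((if i = j then (1 : ℝ) else 0) - N (x, t) i * N (x, t) j) * pdx i f x t

/-- Surface gradient `grad_Γ f = (∂_1^Γ f, ∂_2^Γ f, ∂_3^Γ f)`. -/
def sgrad (N : E3 × ℝ → E3) (f : E3 × ℝ → ℝ) (x : E3) (t : ℝ) : E3 :=
  (EuclideanSpace.equiv (Fin 3) ℝ).symm fun j => tder N j f x t

/-- Surface divergence `div_Γ φ = Σ_j ∂_j^Γ φ_j`. -/
def sdiv (N : E3 × ℝ → E3) (φ : E3 × ℝ → E3) (x : E3) (t : ℝ) : ℝ :=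
  ∑ j, tder N j (fun p => φ p j) x t

/-- Row-wise surface divergence of a matrix field: `(div_Γ M)_i = Σ_j ∂_j^Γ M_{ij}`. -/
def sdivM (N : E3 × ℝ → E3) (M : E3 × ℝ → Matrix (Fin 3) (Fin 3) ℝ) (x : E3) (t : ℝ) : E3 :=
  (EuclideanSpace.equiv (Fin 3) ℝ).symm fun i => ∑ j, tder N j (fun p => M p i j) x t

/-- The orthogonal projection matrix `P_Γ = I − N ⊗ N`. -/
def Pmat (N : E3 × ℝ → E3) (x : E3) (t : ℝ) : Matrix (Fin 3) (Fin 3) ℝ :=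
  Matrix.of fun i j => (if i = j then (1 : ℝ) else 0) - N (x, t) i * N (x, t) j

/-- The symmetric gradient `D(φ) = ((∇φ) + (∇φ)ᵀ)/2`. -/
def Dmat (φ : E3 × ℝ → E3) (x : E3) (t : ℝ) : Matrix (Fin 3) (Fin 3) ℝ :=
  Matrix.of fun i j => (pdx i (fun p => φ p j) x t + pdx j (fun p => φ p i) x t) / 2

/-- The surface stretching tensor `D_Γ(φ) = P_Γ D(φ) P_Γ`. -/
def DGam (N : E3 × ℝ → E3) (φ : E3 × ℝ → E3) (x : E3) (t : ℝ) : Matrix (Fin 3) (Fin 3) ℝ :=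
  Pmat N x t * Dmat φ x t * Pmat N x t

/-- The squared Frobenius norm `|M|² = Σ_{i,j} M_{ij}²`. -/
def frob2 (M : Matrix (Fin 3) (Fin 3) ℝ) : ℝ := ∑ i, ∑ j, (M i j) ^ 2

/-- The material derivative `D_t f = ∂_t f + (v · ∇)f`. -/
def Dt (v : E3 × ℝ → E3) (f : E3 × ℝ → ℝ) (x : E3) (t : ℝ) : ℝ :=
  pdt f x t + ∑ i, v (x, t) i * pdx i f x t

/-- Matrix-vector product on ℝ³. -/
def mulVec3 (M : Matrix (Fin 3) (Fin 3) ℝ) (w : E3) : E3 :=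
  (EuclideanSpace.equiv (Fin 3) ℝ).symm (M.mulVec fun i => w i)

section AreaFormula

open Set Module Topology Filter
open scoped NNReal ENNReal

/-- If `f` expands distances on `s` by at most a factor `r` relative to `g`, then the Hausdorff
measure of `f '' s` is at most `r ^ d` times that of `g '' s`. -/
theorem hausdorffMeasure_image_le_of_dist_le {X Y Z : Type*} [MetricSpace Y] [MetricSpace Z]
    [MeasurableSpace Y] [BorelSpace Y] [MeasurableSpace Z] [BorelSpace Z]
    {f : X → Y} {g : X → Z} {s : Set X} {r : ℝ≥0} {d : ℝ} (hd : 0 ≤ d)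
    (h : ∀ x ∈ s, ∀ y ∈ s, dist (f x) (f y) ≤ r * dist (g x) (g y)) :
    μH[d] (f '' s) ≤ (r : ℝ≥0∞) ^ d * μH[d] (g '' s) := by
  rcases s.eq_empty_or_nonempty with rfl | ⟨x₀, -⟩
  · simp
  have : Nonempty X := ⟨x₀⟩
  have hinv : ∀ x ∈ s, Function.invFunOn g s (g x) ∈ s ∧ g (Function.invFunOn g s (g x)) = g x :=
    fun x hx => Function.invFunOn_pos ⟨x, hx, rfl⟩
  have himage : f '' s = (f ∘ Function.invFunOn g s) '' (g '' s) := by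
    rw [image_image]
    refine image_congr fun x hx => ?_
    have := h x hx _ (hinv x hx).1
    rw [(hinv x hx).2, dist_self, mul_zero] at this
    exact dist_le_zero.1 this
  rw [himage]
  refine LipschitzOnWith.hausdorffMeasure_image_le (LipschitzOnWith.of_dist_le_mul ?_) hd
  rintro _ ⟨x, hx, rfl⟩ _ ⟨y, hy, rfl⟩
  have := h _ (hinv x hx).1 _ (hinv y hy).1
  rwa [(hinv x hx).2, (hinv y hy).2] at this

variable {E F : Type*} [NormedAddCommGroup E] [InnerProductSpace ℝ E] [FiniteDimensional ℝ E]
  [NormedAddCommGroup F] [InnerProductSpace ℝ F]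

theorem continuous_normDet : Continuous fun L : E →L[ℝ] F => L.toLinearMap.normDet := by
  have h : ∀ L : E →L[ℝ] F, L.toLinearMap.normDet =
      √(Matrix.of fun i j => inner ℝ (L (stdOrthonormalBasis ℝ E i))
        (L (stdOrthonormalBasis ℝ E j))).det := by
    intro L
    rw [eq_comm, ← Real.sqrt_sq L.toLinearMap.normDet_nonneg]
    exact congrArg _ (L.toLinearMap.normDet_sq_eq_det_gram (stdOrthonormalBasis ℝ E)).symm
  simp_rw [h]
  refine Real.continuous_sqrt.comp (Continuous.matrix_det ?_)
  fun_prop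

/-- Near a point where the strict derivative `L` is injective, `f` and `L` distort distances
almost equally. -/
theorem HasStrictFDerivAt.eventually_dist_le {f : E → F} {L : E →L[ℝ] F} {a : E}
    (hf : HasStrictFDerivAt f L a) (hL : Function.Injective L) {r : ℝ≥0} (hr : 1 < r) :
    ∃ s ∈ 𝓝 a, ∀ x ∈ s, ∀ y ∈ s, dist (f x) (f y) ≤ r * dist (L x) (L y) ∧
      dist (L x) (L y) ≤ r * dist (f x) (f y) := by
  obtain ⟨K, hK, hLK⟩ := L.toLinearMap.exists_antilipschitzWith (LinearMap.ker_eq_bot.2 hL)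
  have hr' : (1 : ℝ) < r := by exact_mod_cast hr
  have hη : 0 < 1 - (r : ℝ)⁻¹ := sub_pos.2 (inv_lt_one_of_one_lt₀ hr')
  have hKr : (0 : ℝ) < K := by exact_mod_cast hK
  obtain ⟨c, hc0, hc⟩ : ∃ c : ℝ≥0, 0 < c ∧ (c : ℝ) * K = 1 - (r : ℝ)⁻¹ :=
    ⟨⟨(1 - (r : ℝ)⁻¹) / K, (div_pos hη hKr).le⟩, NNReal.coe_pos.1 (div_pos hη hKr),
      div_mul_cancel₀ _ hKr.ne'⟩
  obtain ⟨s, hs, happ⟩ := hf.approximates_deriv_on_nhds (Or.inr hc0)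
  refine ⟨s, hs, fun x hx y hy => ?_⟩
  have h1 := happ x hx y hy
  have h2 : ‖x - y‖ ≤ K * ‖L (x - y)‖ := by
    simpa [dist_eq_norm] using hLK.le_mul_dist x y
  have h3 : ‖f x - f y - L (x - y)‖ ≤ (1 - (r : ℝ)⁻¹) * ‖L (x - y)‖ := by
    calc _ ≤ (c : ℝ) * ‖x - y‖ := h1
      _ ≤ c * (K * ‖L (x - y)‖) := by gcongr
      _ = _ := by rw [← hc, mul_assoc]
  rw [dist_eq_norm, dist_eq_norm, ← map_sub]
  have h4 := norm_sub_norm_le (f x - f y) (L (x - y))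
  have h5 := norm_sub_norm_le (L (x - y)) (f x - f y)
  rw [norm_sub_rev (L (x - y))] at h5
  have hrr : (r : ℝ) * (r : ℝ)⁻¹ = 1 := mul_inv_cancel₀ (by positivity)
  have hsum : 2 - (r : ℝ)⁻¹ ≤ r := by nlinarith [sq_nonneg ((r : ℝ) - 1)]
  constructor
  · nlinarith [norm_nonneg (L (x - y))]
  · have : (r : ℝ)⁻¹ * ‖L (x - y)‖ ≤ ‖f x - f y‖ := by linarith
    calc ‖L (x - y)‖ = r * ((r : ℝ)⁻¹ * ‖L (x - y)‖) := by rw [← mul_assoc, hrr, one_mul]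
      _ ≤ _ := by gcongr

variable [MeasurableSpace E] [BorelSpace E] [MeasurableSpace F] [BorelSpace F]

theorem exists_nhds_hausdorffMeasure_image_le {f : E → F} {f' : E → E →L[ℝ] F} {a : E}
    (hf : HasStrictFDerivAt f (f' a) a) (hf' : ContinuousAt f' a)
    (hinj : Function.Injective (f' a)) {r : ℝ≥0} (hr : 1 < r) :
    ∃ s ∈ 𝓝 a, ∀ A ⊆ s, MeasurableSet A →
      μH[finrank ℝ E] (f '' A) ≤ (r : ℝ≥0∞) ^ (finrank ℝ E + 1) *
        ∫⁻ x in A, ENNReal.ofReal (f' x).toLinearMap.normDet ∂μH[finrank ℝ E] ∧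
      ∫⁻ x in A, ENNReal.ofReal (f' x).toLinearMap.normDet ∂μH[finrank ℝ E] ≤
        (r : ℝ≥0∞) ^ (finrank ℝ E + 1) * μH[finrank ℝ E] (f '' A) := by
  obtain ⟨s, hs, hdist⟩ := hf.eventually_dist_le hinj hr
  set J : E → ℝ := fun x => (f' x).toLinearMap.normDet
  have hJ : ContinuousAt J a := continuous_normDet.continuousAt.comp hf'
  have hJa0 : J a ≠ 0 := ((f' a).toLinearMap.normDet_ne_zero_tfae.out 0 4).2 hinj
  have hJa : 0 < J a := (LinearMap.normDet_nonneg _).lt_of_ne' hJa0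
  have hr' : (1 : ℝ) < r := by exact_mod_cast hr
  have hr0 : (0 : ℝ) < r := zero_lt_one.trans hr'
  have hupper : ∀ᶠ x in 𝓝 a, J x < r * J a :=
    hJ.eventually_lt continuousAt_const (by nlinarith)
  have hlower : ∀ᶠ x in 𝓝 a, J a < r * J x :=
    continuousAt_const.eventually_lt (continuousAt_const.mul hJ) (by nlinarith)
  refine ⟨s ∩ ({x | J x < r * J a} ∩ {x | J a < r * J x}),
    inter_mem hs (inter_mem hupper hlower), fun A hA hAm => ?_⟩
  have hlin := (f' a).toLinearMap.hausdorffMeasure_image A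
  simp only [ContinuousLinearMap.coe_coe] at hlin
  have h1 : μH[finrank ℝ E] (f '' A) ≤ (r : ℝ≥0∞) ^ finrank ℝ E * μH[finrank ℝ E] (f' a '' A) := by
    rw [← ENNReal.rpow_natCast]
    exact hausdorffMeasure_image_le_of_dist_le (by positivity)
      fun x hx y hy => (hdist x (hA hx).1 y (hA hy).1).1
  have h2 : μH[finrank ℝ E] (f' a '' A) ≤ (r : ℝ≥0∞) ^ finrank ℝ E * μH[finrank ℝ E] (f '' A) := by
    rw [← ENNReal.rpow_natCast]
    exact hausdorffMeasure_image_le_of_dist_le (by positivity)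
      fun x hx y hy => (hdist x (hA hx).1 y (hA hy).1).2
  have hofReal : ∀ y : ℝ, ENNReal.ofReal (r * y) = r * ENNReal.ofReal y := fun y => by
    rw [ENNReal.ofReal_mul hr0.le, ENNReal.ofReal_coe_nnreal]
  have h3 : ENNReal.ofReal (J a) * μH[finrank ℝ E] A ≤
      r * ∫⁻ x in A, ENNReal.ofReal (J x) ∂μH[finrank ℝ E] := by
    rw [← setLIntegral_const, ← lintegral_const_mul' _ _ ENNReal.coe_ne_top]
    refine setLIntegral_mono' hAm fun x hx => ?_
    rw [← hofReal]
    exact ENNReal.ofReal_le_ofReal (hA hx).2.2.le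
  have h4 : ∫⁻ x in A, ENNReal.ofReal (J x) ∂μH[finrank ℝ E] ≤
      r * (ENNReal.ofReal (J a) * μH[finrank ℝ E] A) := by
    rw [← mul_assoc, ← setLIntegral_const]
    refine setLIntegral_mono' hAm fun x hx => ?_
    rw [← hofReal]
    exact ENNReal.ofReal_le_ofReal (hA hx).2.1.le
  rw [hlin] at h1 h2
  constructor
  · calc _ ≤ _ := h1
      _ ≤ (r : ℝ≥0∞) ^ finrank ℝ E * (r * ∫⁻ x in A, ENNReal.ofReal (J x) ∂μH[finrank ℝ E]) := by
        gcongr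
      _ = _ := by rw [pow_succ, mul_assoc]
  · calc _ ≤ _ := h4
      _ ≤ r * ((r : ℝ≥0∞) ^ finrank ℝ E * μH[finrank ℝ E] (f '' A)) := by gcongr
      _ = _ := by rw [pow_succ', mul_assoc]

/-- **Area formula** for an injective immersion between inner product spaces. -/
theorem hausdorffMeasure_image_eq_lintegral_normDet {f : E → F} {f' : E → E →L[ℝ] F} {W A : Set E}
    (hf : ∀ x ∈ W, HasStrictFDerivAt f (f' x) x) (hf' : ∀ x ∈ W, ContinuousAt f' x)
    (hinj' : ∀ x ∈ W, Function.Injective (f' x)) (hinj : InjOn f W)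
    (hA : MeasurableSet A) (hAW : A ⊆ W) :
    μH[finrank ℝ E] (f '' A) =
      ∫⁻ x in A, ENNReal.ofReal (f' x).toLinearMap.normDet ∂μH[finrank ℝ E] := by
  have hcont : ContinuousOn f W := fun x hx => (hf x hx).continuousAt.continuousWithinAt
  suffices key : ∀ r : ℝ≥0, 1 < r →
      μH[finrank ℝ E] (f '' A) ≤ (r : ℝ≥0∞) ^ (finrank ℝ E + 1) *
        ∫⁻ x in A, ENNReal.ofReal (f' x).toLinearMap.normDet ∂μH[finrank ℝ E] ∧
      ∫⁻ x in A, ENNReal.ofReal (f' x).toLinearMap.normDet ∂μH[finrank ℝ E] ≤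
        (r : ℝ≥0∞) ^ (finrank ℝ E + 1) * μH[finrank ℝ E] (f '' A) by
    have hlim : ∀ b : ℝ≥0∞, Tendsto (fun r : ℝ≥0 => (r : ℝ≥0∞) ^ (finrank ℝ E + 1) * b)
        (𝓝[>] 1) (𝓝 b) := by
      intro b
      have : Tendsto (fun r : ℝ≥0 => (r : ℝ≥0∞) ^ (finrank ℝ E + 1)) (𝓝[>] 1) (𝓝 1) := by
        have h : Continuous fun r : ℝ≥0 => (r : ℝ≥0∞) ^ (finrank ℝ E + 1) :=
          (ENNReal.continuous_pow _).comp ENNReal.continuous_coe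
        simpa using (h.tendsto 1).mono_left nhdsWithin_le_nhds
      simpa using ENNReal.Tendsto.mul_const this (Or.inl one_ne_zero)
    have hev : ∀ᶠ r : ℝ≥0 in 𝓝[>] 1, 1 < r := self_mem_nhdsWithin
    exact le_antisymm (ge_of_tendsto (hlim _) (hev.mono fun r hr => (key r hr).1))
      (ge_of_tendsto (hlim _) (hev.mono fun r hr => (key r hr).2))
  intro r hr
  choose! s hs hbound using fun x hx =>
    exists_nhds_hausdorffMeasure_image_le (hf x hx) (hf' x hx) (hinj' x hx) hr
  obtain ⟨t, htW, htc, hcover⟩ := TopologicalSpace.countable_cover_nhdsWithin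
    (s := W) (f := fun x => interior (s x))
    fun x hx => mem_nhdsWithin_of_mem_nhds (interior_mem_nhds.2 (hs x hx))
  rcases t.eq_empty_or_nonempty with rfl | htne
  · have : A = ∅ := by simpa using hAW.trans hcover
    simp [this]
  obtain ⟨x, hx⟩ := htc.exists_eq_range htne
  set D : ℕ → Set E := disjointed fun n => interior (s (x n))
  have hDm : ∀ n, MeasurableSet (A ∩ D n) := fun n =>
    hA.inter (MeasurableSet.disjointed (fun n => isOpen_interior.measurableSet) n)
  have hDd : Pairwise (Function.onFun Disjoint fun n => A ∩ D n) := fun i j hij =>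
    (disjoint_disjointed _ hij).mono inter_subset_right inter_subset_right
  have hAD : A = ⋃ n, A ∩ D n := by
    rw [← inter_iUnion, iUnion_disjointed, eq_comm, inter_eq_left]
    refine hAW.trans (hcover.trans ?_)
    rw [hx, biUnion_range]
  have hAn : ∀ n, A ∩ D n ⊆ W := fun n => inter_subset_left.trans hAW
  have h1 : μH[finrank ℝ E] (f '' A) = ∑' n, μH[finrank ℝ E] (f '' (A ∩ D n)) := by
    conv_lhs => rw [hAD, image_iUnion]
    refine measure_iUnion (fun i j hij => ?_) fun n =>
      (hDm n).image_of_continuousOn_injOn (hcont.mono (hAn n)) (hinj.mono (hAn n))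
    exact (hDd hij).image hinj (hAn i) (hAn j)
  have h2 : ∫⁻ x in A, ENNReal.ofReal (f' x).toLinearMap.normDet ∂μH[finrank ℝ E] =
      ∑' n, ∫⁻ x in A ∩ D n, ENNReal.ofReal (f' x).toLinearMap.normDet ∂μH[finrank ℝ E] := by
    conv_lhs => rw [hAD]
    exact lintegral_iUnion hDm hDd _
  have hb := fun n => hbound (x n) (htW (hx ▸ mem_range_self n)) (A ∩ D n)
    (inter_subset_right.trans ((disjointed_subset _ n).trans interior_subset)) (hDm n)
  rw [h1, h2, ← ENNReal.tsum_mul_left, ← ENNReal.tsum_mul_left]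
  exact ⟨ENNReal.tsum_le_tsum fun n => (hb n).1, ENNReal.tsum_le_tsum fun n => (hb n).2⟩

/-- Change of variables along an injective immersion between inner product spaces. -/
theorem integral_image_eq_integral_normDet_mul {f : E → F} {f' : E → E →L[ℝ] F} {W : Set E}
    (hfm : Measurable f) (hf'm : Measurable f') (hW : MeasurableSet W)
    (hf : ∀ x ∈ W, HasStrictFDerivAt f (f' x) x) (hf' : ∀ x ∈ W, ContinuousAt f' x)
    (hinj' : ∀ x ∈ W, Function.Injective (f' x)) (hinj : InjOn f W)
    {g : F → ℝ} (hg : StronglyMeasurable g) :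
    ∫ y in f '' W, g y ∂μH[finrank ℝ E] =
      ∫ x in W, (f' x).toLinearMap.normDet * g (f x) ∂μH[finrank ℝ E] := by
  have hcont : ContinuousOn f W := fun x hx => (hf x hx).continuousAt.continuousWithinAt
  have hJ : Measurable fun x => Real.toNNReal (f' x).toLinearMap.normDet :=
    (continuous_normDet.measurable.comp hf'm).real_toNNReal
  have hmeas : (μH[finrank ℝ E] : Measure F).restrict (f '' W) =
      (((μH[finrank ℝ E] : Measure E).restrict W).withDensity fun x =>
        ((Real.toNNReal (f' x).toLinearMap.normDet : ℝ≥0) : ℝ≥0∞)).map f := by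
    ext B hB
    rw [Measure.restrict_apply hB, Measure.map_apply hfm hB, withDensity_apply _ (hfm hB),
      Measure.restrict_restrict (hfm hB), inter_comm, ← image_inter_preimage, inter_comm]
    exact hausdorffMeasure_image_eq_lintegral_normDet hf hf' hinj' hinj ((hfm hB).inter hW)
      inter_subset_right
  rw [hmeas, integral_map hfm.aemeasurable hg.aestronglyMeasurable,
    integral_withDensity_eq_integral_smul hJ]
  refine integral_congr_ae (Eventually.of_forall fun x => ?_)
  simp [NNReal.smul_def, LinearMap.normDet_nonneg]

end AreaFormula

section EvolvingSurface

open Topology Filter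

theorem gVec_eq_fderiv {xh : E2 × ℝ → E3} (h : Differentiable ℝ xh) (α : Fin 2) (X : E2) (t : ℝ) :
    gVec xh α X t = fderiv ℝ xh (X, t) (EuclideanSpace.single α 1, 0) := by
  have := (h (X, t)).hasFDerivAt.comp X (hasFDerivAt_prodMk_left (𝕜 := ℝ) X t)
  rw [gVec, show (fun Y : E2 => xh (Y, t)) = xh ∘ fun Y => (Y, t) from rfl, this.fderiv]
  simp

theorem pdx_eq_fderiv {f : E3 × ℝ → ℝ} (h : Differentiable ℝ f) (j : Fin 3) (x : E3) (t : ℝ) :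
    pdx j f x t = fderiv ℝ f (x, t) (EuclideanSpace.single j 1, 0) := by
  have := (h (x, t)).hasFDerivAt.comp x (hasFDerivAt_prodMk_left (𝕜 := ℝ) x t)
  rw [pdx, show (fun y : E3 => f (y, t)) = f ∘ fun y => (y, t) from rfl, this.fderiv]
  simp

theorem pdt_eq_fderiv {f : E3 × ℝ → ℝ} (h : Differentiable ℝ f) (x : E3) (t : ℝ) :
    pdt f x t = fderiv ℝ f (x, t) (0, 1) := by
  have := (h (x, t)).hasFDerivAt.comp_hasDerivAt t ((hasDerivAt_const t x).prodMk (hasDerivAt_id t))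
  exact this.deriv

theorem fderiv_apply_eq_sum_pdx {f : E3 × ℝ → ℝ} (h : Differentiable ℝ f) (x w : E3) (t : ℝ) :
    fderiv ℝ f (x, t) (w, 0) = ∑ i, w i * pdx i f x t := by
  have hw : w = ∑ i, w i • EuclideanSpace.single i (1 : ℝ) := by
    simpa using ((EuclideanSpace.basisFun (Fin 3) ℝ).sum_repr w).symm
  have hlin : fderiv ℝ f (x, t) (w, 0) =
      (fderiv ℝ f (x, t) ∘L ContinuousLinearMap.inl ℝ E3 ℝ) w := by simp
  rw [hlin]
  conv_lhs => rw [hw]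
  simp [pdx_eq_fderiv h]

theorem Dt_eq_fderiv {v : E3 × ℝ → E3} {f : E3 × ℝ → ℝ} (h : Differentiable ℝ f) (x : E3) (t : ℝ) :
    Dt v f x t = fderiv ℝ f (x, t) (v (x, t), 1) := by
  rw [Dt, pdt_eq_fderiv h, ← fderiv_apply_eq_sum_pdx h, ← map_add]
  simp

theorem continuous_pdx {f : E3 × ℝ → ℝ} (h : ContDiff ℝ 1 f) (j : Fin 3) :
    Continuous fun p : E3 × ℝ => pdx j f p.1 p.2 := by
  simp_rw [pdx_eq_fderiv (h.differentiable one_ne_zero)]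
  exact (h.continuous_fderiv one_ne_zero).clm_apply continuous_const

theorem continuous_Dt {v : E3 × ℝ → E3} {f : E3 × ℝ → ℝ} (hv : Continuous v)
    (h : ContDiff ℝ 1 f) : Continuous fun p : E3 × ℝ => Dt v f p.1 p.2 := by
  simp_rw [Dt_eq_fderiv (h.differentiable one_ne_zero)]
  exact (h.continuous_fderiv one_ne_zero).clm_apply (by fun_prop)

theorem contDiff_coord {v : E3 × ℝ → E3} {n : WithTop ℕ∞} (hv : ContDiff ℝ n v) (j : Fin 3) :
    ContDiff ℝ n fun p => v p j :=
  (contDiff_euclidean.1 hv) j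

theorem continuous_sdiv {N v : E3 × ℝ → E3} (hN : Continuous N) (hv : ContDiff ℝ 1 v) :
    Continuous fun p : E3 × ℝ => sdiv N v p.1 p.2 := by
  have hc := fun i j => continuous_pdx (contDiff_coord hv j) i
  have hNc : ∀ i, Continuous fun p => N p i := fun i =>
    (EuclideanSpace.proj i).continuous.comp hN
  unfold sdiv tder
  refine continuous_finsetSum _ fun j _ => continuous_finsetSum _ fun i _ => ?_
  exact (continuous_const.sub ((hNc i).mul (hNc j))).mul (hc i j)

theorem continuous_gVec {xh : E2 × ℝ → E3} (h : ContDiff ℝ 1 xh) (α : Fin 2) :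
    Continuous fun p : E2 × ℝ => gVec xh α p.1 p.2 := by
  simp_rw [gVec_eq_fderiv (h.differentiable one_ne_zero)]
  exact (h.continuous_fderiv one_ne_zero).clm_apply continuous_const

theorem continuous_Gdet {xh : E2 × ℝ → E3} (h : ContDiff ℝ 1 xh) :
    Continuous fun p : E2 × ℝ => Gdet xh p.1 p.2 := by
  have hc : ∀ (α : Fin 2) (i : Fin 3), Continuous fun p : E2 × ℝ => gVec xh α p.1 p.2 i :=
    fun α i => (EuclideanSpace.proj i).continuous.comp (continuous_gVec h α)
  have hm : ∀ α β : Fin 2, Continuous fun p : E2 × ℝ => gMet xh α β p.1 p.2 := by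
    intro α β
    unfold gMet dot3
    exact continuous_finsetSum _ fun i _ => (hc α i).mul (hc β i)
  exact ((hm 0 0).mul (hm 1 1)).sub ((hm 0 1).mul (hm 1 0))

/-- The area density of the parametrization is the norm determinant of its differential. -/
theorem normDet_fderiv_eq_sqrt_Gdet (xh : E2 × ℝ → E3) (X : E2) (t : ℝ) :
    (fderiv ℝ (fun Y : E2 => xh (Y, t)) X).toLinearMap.normDet = √(Gdet xh X t) := by
  rw [← Real.sqrt_sq (LinearMap.normDet_nonneg _)]
  congr 1
  have h := LinearMap.normDet_sq_eq_det_gram (fderiv ℝ (fun Y : E2 => xh (Y, t)) X).toLinearMap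
    (EuclideanSpace.basisFun (Fin 2) ℝ)
  simp only [RCLike.ofReal_real_eq_id, id_eq] at h
  rw [h, Matrix.det_fin_two]
  have hentry : ∀ α β : Fin 2, Matrix.gram ℝ (fun x =>
      (fderiv ℝ (fun Y : E2 => xh (Y, t)) X).toLinearMap
        (EuclideanSpace.basisFun (Fin 2) ℝ x)) α β = gMet xh β α X t := by
    intro α β
    simp [Matrix.gram_apply, gMet, dot3, gVec, PiLp.inner_apply]
  simp only [hentry, Gdet]
  ring

/-- The material derivative is the time derivative along particle paths. -/
theorem hasDerivAt_along_flow {xh : E2 × ℝ → E3} {v : E3 × ℝ → E3} {f : E3 × ℝ → ℝ}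
    (hxh : Differentiable ℝ xh) (hf : Differentiable ℝ f) {X : E2} {t : ℝ}
    (hflow : deriv (fun s => xh (X, s)) t = v (xh (X, t), t)) :
    HasDerivAt (fun s => f (xh (X, s), s)) (Dt v f (xh (X, t)) t) t := by
  rw [Dt_eq_fderiv hf, ← hflow]
  have hpath : HasDerivAt (fun s => xh (X, s)) (deriv (fun s => xh (X, s)) t) t :=
    DifferentiableAt.hasDerivAt (by fun_prop)
  exact (hf _).hasFDerivAt.comp_hasDerivAt t (hpath.prodMk (hasDerivAt_id t))

/-- The tangent vectors are transported by the velocity gradient. -/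
theorem hasDerivAt_gVec {xh : E2 × ℝ → E3} {v : E3 × ℝ → E3}
    (hxh : ContDiff ℝ 2 xh) (hv : Differentiable ℝ v) {X : E2} {t : ℝ}
    (hflow : ∀ᶠ Y in 𝓝 X, deriv (fun s => xh (Y, s)) t = v (xh (Y, t), t)) (α : Fin 2) (i : Fin 3) :
    HasDerivAt (fun s => gVec xh α X s i)
      (∑ k, gVec xh α X t k * pdx k (fun p => v p i) (xh (X, t)) t) t := by
  have hd : Differentiable ℝ xh := hxh.differentiable two_ne_zero
  have hd' : Differentiable ℝ (fderiv ℝ xh) :=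
    (hxh.fderiv_right (m := 1) (by norm_num)).differentiable one_ne_zero
  have hvi : Differentiable ℝ fun p => v p i := fun p =>
    (differentiableAt_euclidean.1 (hv p)) i
  set e : E2 := EuclideanSpace.single α 1
  set B := fderiv ℝ (fderiv ℝ xh) (X, t)
  have hB : HasFDerivAt (fderiv ℝ xh) B (X, t) := (hd' _).hasFDerivAt
  have hsymm : B (0, 1) (e, 0) = B (e, 0) (0, 1) :=
    (hxh.contDiffAt.isSymmSndFDerivAt (by simp)) _ _
  have hpath : HasDerivAt (fun s : ℝ => (X, s)) ((0 : E2), (1 : ℝ)) t :=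
    (hasDerivAt_const t X).prodMk (hasDerivAt_id t)
  have htime : HasDerivAt (fun s => gVec xh α X s) (B (0, 1) (e, 0)) t := by
    simp_rw [gVec_eq_fderiv hd]
    have := (hB.comp_hasDerivAt t hpath).clm_apply (hasDerivAt_const t (e, (0 : ℝ)))
    simpa using this
  have hvel : ∀ Y, deriv (fun s => xh (Y, s)) t = fderiv ℝ xh (Y, t) (0, 1) := fun Y =>
    ((hd (Y, t)).hasFDerivAt.comp_hasDerivAt t
      ((hasDerivAt_const t Y).prodMk (hasDerivAt_id t))).deriv
  have hinl := hasFDerivAt_prodMk_left (𝕜 := ℝ) X t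
  have hspace : HasFDerivAt (fun Y => fderiv ℝ xh (Y, t) (0, 1))
      ((B.comp (ContinuousLinearMap.inl ℝ E2 ℝ)).flip (0, 1)) X := by
    have := (hB.comp X hinl).clm_apply (hasFDerivAt_const ((0 : E2), (1 : ℝ)) X)
    simpa using this
  have hx : HasFDerivAt (fun Y => xh (Y, t))
      ((fderiv ℝ xh (X, t)).comp (ContinuousLinearMap.inl ℝ E2 ℝ)) X :=
    (hd (X, t)).hasFDerivAt.comp X hinl
  have hcomp : HasFDerivAt (fun Y => v (xh (Y, t), t))
      ((fderiv ℝ v (xh (X, t), t)).comp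
        (((fderiv ℝ xh (X, t)).comp (ContinuousLinearMap.inl ℝ E2 ℝ)).prod 0)) X :=
    (hv (xh (X, t), t)).hasFDerivAt.comp X (hx.prodMk (hasFDerivAt_const t X))
  have huniq := (hspace.congr_of_eventuallyEq (hflow.mono fun Y hY => by
    rw [← hY, hvel])).unique hcomp
  have hval : B (0, 1) (e, 0) = fderiv ℝ v (xh (X, t), t) (gVec xh α X t, 0) := by
    rw [hsymm, gVec_eq_fderiv hd]
    simpa using congrArg (fun L : E2 →L[ℝ] E3 => L e) huniq
  have hcoord := (EuclideanSpace.proj (𝕜 := ℝ) i : E3 →L[ℝ] ℝ).hasFDerivAt.comp_hasDerivAt t htime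
  rw [← fderiv_apply_eq_sum_pdx hvi]
  have hfi := ((EuclideanSpace.proj (𝕜 := ℝ) i : E3 →L[ℝ] ℝ).hasFDerivAt.comp (xh (X, t), t)
    (hv (xh (X, t), t)).hasFDerivAt).fderiv
  refine hcoord.congr_deriv ?_
  rw [hval]
  symm
  exact congrArg (fun L : E3 × ℝ →L[ℝ] ℝ => L (gVec xh α X t, 0)) hfi

/-- Lagrange's identity: the Gram determinant is `|g₁ × g₂|²`. -/
theorem Gdet_eq_norm_cross_sq (xh : E2 × ℝ → E3) (X : E2) (t : ℝ) :
    Gdet xh X t = ‖cross3 (gVec xh 0 X t) (gVec xh 1 X t)‖ ^ 2 := by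
  simp [EuclideanSpace.norm_sq_eq, cross3, Gdet, gMet, dot3, Fin.sum_univ_three]
  ring

/-- Evolution of the area density: `∂ₜ G = 2 G div_Γ v`. -/
theorem hasDerivAt_Gdet {xh : E2 × ℝ → E3} {v N : E3 × ℝ → E3}
    (hxh : ContDiff ℝ 2 xh) (hv : Differentiable ℝ v) {X : E2} {t : ℝ}
    (hflow : ∀ᶠ Y in 𝓝 X, deriv (fun s => xh (Y, s)) t = v (xh (Y, t), t))
    (hN : N (xh (X, t), t) = nHat xh X t) (hG : 0 < Gdet xh X t) :
    HasDerivAt (fun s => Gdet xh X s) (2 * Gdet xh X t * sdiv N v (xh (X, t)) t) t := by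
  have hg := fun α i => hasDerivAt_gVec hxh hv hflow α i
  have hmet : ∀ α β, HasDerivAt (fun s => gMet xh α β X s)
      (∑ i, ((∑ k, gVec xh α X t k * pdx k (fun p => v p i) (xh (X, t)) t) * gVec xh β X t i +
        gVec xh α X t i * ∑ k, gVec xh β X t k * pdx k (fun p => v p i) (xh (X, t)) t)) t := by
    intro α β
    unfold gMet dot3
    exact HasDerivAt.fun_sum fun i _ => (hg α i).fun_mul (hg β i)
  refine (((hmet 0 0).mul (hmet 1 1)).sub ((hmet 0 1).mul (hmet 1 0))).congr_deriv ?_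
  have hGc := Gdet_eq_norm_cross_sq xh X t
  set w := cross3 (gVec xh 0 X t) (gVec xh 1 X t) with hw
  have hw0 : ‖w‖ ≠ 0 := by
    intro h
    simp [hGc, h] at hG
  have hNN : ∀ i j, Gdet xh X t * (N (xh (X, t), t) i * N (xh (X, t), t) j) = w i * w j := by
    intro i j
    rw [hN, hGc, nHat, ← hw]
    simp only [PiLp.smul_apply, smul_eq_mul]
    field_simp
  have hsd : 2 * Gdet xh X t * sdiv N v (xh (X, t)) t =
      2 * ∑ j, ∑ i, ((if i = j then Gdet xh X t else 0) - w i * w j) *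
        pdx i (fun p => v p j) (xh (X, t)) t := by
    simp_rw [sdiv, tder, mul_assoc, Finset.mul_sum, ← hNN]
    refine Finset.sum_congr rfl fun j _ => Finset.sum_congr rfl fun i _ => ?_
    split_ifs <;> ring
  rw [hsd, hw]
  simp only [Gdet, gMet]
  generalize gVec xh 0 X t = a, gVec xh 1 X t = b
  simp [cross3, dot3, Fin.sum_univ_three]
  ring

/-- The integrand transported to the reference domain satisfies
`∂ₜ (√G ρ) = √G (D_t ρ + (div_Γ v) ρ)`. -/
theorem hasDerivAt_sqrt_Gdet_mul {xh : E2 × ℝ → E3} {v N : E3 × ℝ → E3} {ρ : E3 × ℝ → ℝ}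
    (hxh : ContDiff ℝ 2 xh) (hv : Differentiable ℝ v) (hρ : Differentiable ℝ ρ) {X : E2} {t : ℝ}
    (hflow : ∀ᶠ Y in 𝓝 X, deriv (fun s => xh (Y, s)) t = v (xh (Y, t), t))
    (hN : N (xh (X, t), t) = nHat xh X t) (hG : 0 < Gdet xh X t) :
    HasDerivAt (fun s => √(Gdet xh X s) * ρ (xh (X, s), s))
      (√(Gdet xh X t) *
        (Dt v ρ (xh (X, t)) t + sdiv N v (xh (X, t)) t * ρ (xh (X, t), t))) t := by
  refine (((hasDerivAt_Gdet hxh hv hflow hN hG).sqrt hG.ne').mul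
    (hasDerivAt_along_flow (hxh.differentiable two_ne_zero) hρ hflow.self_of_nhds)).congr_deriv ?_
  have h0 : √(Gdet xh X t) ≠ 0 := (Real.sqrt_pos.2 hG).ne'
  field_simp
  rw [Real.sq_sqrt hG.le]
  ring

/-- A function whose integral over every small ball around `a` vanishes and which is continuous
at `a` vanishes at `a`. -/
theorem eq_zero_of_setIntegral_ball_eq_zero {E : Type*} [NormedAddCommGroup E] [NormedSpace ℝ E]
    [FiniteDimensional ℝ E] [MeasurableSpace E] [BorelSpace E] (μ : Measure E)
    [μ.IsAddHaarMeasure] {f : E → ℝ} {a : E} (hf : Continuous f)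
    (h : ∀ᶠ ε in 𝓝[>] (0 : ℝ), ∫ x in Metric.ball a ε, f x ∂μ = 0) : f a = 0 := by
  refine abs_eq_zero.1 (le_antisymm (le_of_forall_pos_le_add fun η hη => ?_) (abs_nonneg _))
  obtain ⟨δ, hδ, hball⟩ := Metric.continuousAt_iff.1 hf.continuousAt η hη
  obtain ⟨ε, hintOn, hε0, hεδ⟩ :=
    (h.and (Ioo_mem_nhdsGT hδ)).exists
  have hfin : μ (Metric.ball a ε) < ⊤ := measure_ball_lt_top
  have hpos : 0 < μ.real (Metric.ball a ε) :=
    ENNReal.toReal_pos (Metric.measure_ball_pos μ a hε0).ne' hfin.ne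
  have hfi : IntegrableOn f (Metric.ball a ε) μ :=
    (hf.continuousOn.integrableOn_compact (isCompact_closedBall a ε)).mono_set
      Metric.ball_subset_closedBall
  have hb := norm_setIntegral_le_of_norm_le_const (f := fun x => f x - f a) hfin
    fun x hx => (by simpa [dist_eq_norm] using (hball (lt_trans hx hεδ)).le : ‖f x - f a‖ ≤ η)
  rw [integral_sub hfi (integrableOn_const hfin.ne), hintOn, setIntegral_const] at hb
  simp only [smul_eq_mul, zero_sub, norm_neg, norm_mul, Real.norm_eq_abs, abs_of_pos hpos] at hb
  rw [zero_add]
  nlinarith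

end EvolvingSurface

section MassConservation

open Topology Filter

theorem isAddHaarMeasure_hausdorffMeasure_two :
    (μH[2] : Measure E2).IsAddHaarMeasure := by
  have := isAddHaarMeasure_hausdorffMeasure (E := E2)
  simpa using this

/-- Surface integrals over a portion of `Γ(t)` in the coordinates of the parametrization. -/
theorem integral_image_eq_integral_sqrt_Gdet_mul {xh : E2 × ℝ → E3} (hxh : ContDiff ℝ 1 xh)
    {ρ : E3 × ℝ → ℝ} (hρ : Continuous ρ) {V : Set E2} (hV : MeasurableSet V) {t : ℝ}
    (hinj : Set.InjOn (fun X => xh (X, t)) V) (hG : ∀ X ∈ V, 0 < Gdet xh X t) :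
    ∫ x in (fun X => xh (X, t)) '' V, ρ (x, t) ∂(μH[2] : Measure E3) =
      ∫ X in V, √(Gdet xh X t) * ρ (xh (X, t), t) ∂(μH[2] : Measure E2) := by
  have hf : ContDiff ℝ 1 fun X => xh (X, t) := hxh.comp (contDiff_prodMk_left t)
  have hf' : Continuous (fderiv ℝ fun X => xh (X, t)) := hf.continuous_fderiv one_ne_zero
  have hnd := fun X => normDet_fderiv_eq_sqrt_Gdet xh X t
  have hinj' : ∀ X ∈ V, Function.Injective (fderiv ℝ (fun X => xh (X, t)) X) := fun X hX =>
    ((LinearMap.normDet_ne_zero_tfae _).out 0 4).1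
      ((hnd X).trans_ne (Real.sqrt_pos.2 (hG X hX)).ne')
  have h := integral_image_eq_integral_normDet_mul hf.continuous.measurable hf'.measurable hV
    (fun X _ => hf.contDiffAt.hasStrictFDerivAt one_ne_zero) (fun X _ => hf'.continuousAt)
    hinj' hinj (g := fun x => ρ (x, t)) (Continuous.stronglyMeasurable (by fun_prop))
  simpa [hnd] using h

/-- The transported integrand is continuous. -/
theorem continuous_sqrt_Gdet_mul_continuity {xh : E2 × ℝ → E3} {v N : E3 × ℝ → E3}
    {ρ : E3 × ℝ → ℝ} (hxh : ContDiff ℝ 1 xh) (hv : ContDiff ℝ 1 v) (hN : Continuous N)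
    (hρ : ContDiff ℝ 1 ρ) :
    Continuous fun p : E2 × ℝ => √(Gdet xh p.1 p.2) *
      (Dt v ρ (xh p) p.2 + sdiv N v (xh p) p.2 * ρ (xh p, p.2)) := by
  have hpath : Continuous fun p : E2 × ℝ => (xh p, p.2) := hxh.continuous.prodMk continuous_snd
  exact (continuous_Gdet hxh).sqrt.mul (((continuous_Dt hv.continuous hρ).comp hpath).add
    (((continuous_sdiv hN hv).comp hpath).mul (hρ.continuous.comp hpath)))

/-- Differentiation under the integral sign over a ball for a jointly continuous derivative. -/
theorem hasDerivAt_integral_ball {E : Type*} [NormedAddCommGroup E] [NormedSpace ℝ E]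
    [FiniteDimensional ℝ E] [MeasurableSpace E] [BorelSpace E] (μ : Measure E)
    [IsFiniteMeasureOnCompacts μ] {F F' : E × ℝ → ℝ} (hF : Continuous F) (hF' : Continuous F')
    {a : E} {ε t δ : ℝ} (hδ : 0 < δ)
    (hd : ∀ x ∈ Metric.ball a ε, ∀ s ∈ Metric.ball t δ,
      HasDerivAt (fun s => F (x, s)) (F' (x, s)) s) :
    HasDerivAt (fun s => ∫ x in Metric.ball a ε, F (x, s) ∂μ)
      (∫ x in Metric.ball a ε, F' (x, t) ∂μ) t := by
  have hintOn : ∀ {g : E → ℝ}, Continuous g → IntegrableOn g (Metric.ball a ε) μ := fun hg =>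
    (hg.continuousOn.integrableOn_compact (isCompact_closedBall a ε)).mono_set
      Metric.ball_subset_closedBall
  obtain ⟨C, hC⟩ :=
    ((isCompact_closedBall a ε).prod (isCompact_closedBall t δ)).exists_bound_of_continuousOn
    hF'.continuousOn
  refine (hasDerivAt_integral_of_dominated_loc_of_deriv_le (bound := fun _ => C)
    (F := fun s x => F (x, s)) (F' := fun s x => F' (x, s)) (Metric.ball_mem_nhds t hδ)
    (Eventually.of_forall fun s => (hintOn (by fun_prop)).aestronglyMeasurable) (hintOn (by fun_prop))
    (hintOn (by fun_prop)).aestronglyMeasurable ?_ (hintOn continuous_const) ?_).2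
  · refine (ae_restrict_mem measurableSet_ball).mono fun x hx s hs => hC _ ⟨?_, ?_⟩
    exacts [Metric.ball_subset_closedBall hx, Metric.ball_subset_closedBall hs]
  · exact (ae_restrict_mem measurableSet_ball).mono hd

end MassConservation

/-- if the mass on every portion of the evolving surface is conserved,
then the continuity equation `D_t ρ + (div_Γ v) ρ = 0` holds pointwise. -/
theorem continuity_equation_from_mass_conservation
    (T : ℝ) (hT : 0 < T)
    (U : Set E2) (hUopen : IsOpen U) (hUne : U.Nonempty) (hUbd : Bornology.IsBounded U)
    (xh : E2 × ℝ → E3) (hxh : ContDiff ℝ 2 xh)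
    (lam : ℝ) (hlam : 0 < lam)
    (hG : ∀ X ∈ U, ∀ t ∈ Set.Ico (0 : ℝ) T, lam ≤ Gdet xh X t)
    (hinj : ∀ t ∈ Set.Ico (0 : ℝ) T, Set.InjOn (fun X => xh (X, t)) U)
    (N : E3 × ℝ → E3) (hN : ContDiff ℝ 1 N)
    (hNs : ∀ X ∈ U, ∀ t ∈ Set.Ico (0 : ℝ) T, N (xh (X, t), t) = nHat xh X t)
    (v : E3 × ℝ → E3) (hv : ContDiff ℝ 2 v)
    (hflow : ∀ X ∈ U, ∀ t ∈ Set.Ico (0 : ℝ) T,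
      deriv (fun s => xh (X, s)) t = v (xh (X, t), t))
    (ρ : E3 × ℝ → ℝ) (hρ : ContDiff ℝ 1 ρ)
    (hmass : ∀ V : Set E2, IsOpen V → V ⊆ U → ∀ t ∈ Set.Ioo (0 : ℝ) T,
      HasDerivAt (fun s => ∫ x in (fun X => xh (X, s)) '' V, ρ (x, s) ∂(μH[2] : Measure E3))
        0 t) :
    ∀ X ∈ U, ∀ t ∈ Set.Ioo (0 : ℝ) T,
      Dt v ρ (xh (X, t)) t + sdiv N v (xh (X, t)) t * ρ (xh (X, t), t) = 0 := by
  intro X₀ hX₀ t₀ ht₀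
  have hxh1 : ContDiff ℝ 1 xh := hxh.of_le one_le_two
  have hv1 : ContDiff ℝ 1 v := hv.of_le one_le_two
  have hpos : ∀ X ∈ U, ∀ t ∈ Set.Ico (0 : ℝ) T, 0 < Gdet xh X t := fun X hX t ht =>
    hlam.trans_le (hG X hX t ht)
  have hIco : ∀ {t}, t ∈ Set.Ioo (0 : ℝ) T → t ∈ Set.Ico (0 : ℝ) T := fun h =>
    Set.Ioo_subset_Ico_self h
  obtain ⟨δ, hδ, hδT⟩ := Metric.isOpen_iff.1 isOpen_Ioo t₀ ht₀
  obtain ⟨r, hr, hrU⟩ := Metric.isOpen_iff.1 hUopen X₀ hX₀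
  have hcont := continuous_sqrt_Gdet_mul_continuity hxh1 hv1 hN.continuous hρ
  have hF : Continuous fun p : E2 × ℝ => √(Gdet xh p.1 p.2) * ρ (xh p, p.2) :=
    (continuous_Gdet hxh1).sqrt.mul
      (hρ.continuous.comp (hxh.continuous.prodMk continuous_snd))
  have := isAddHaarMeasure_hausdorffMeasure_two
  have hzero := eq_zero_of_setIntegral_ball_eq_zero (μH[2] : Measure E2) (a := X₀)
    (hcont.comp (Continuous.prodMk_left t₀)) (by
      filter_upwards [Ioo_mem_nhdsGT hr] with ε hε
      have hεU : Metric.ball X₀ ε ⊆ U := (Metric.ball_subset_ball hε.2.le).trans hrU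
      have hderiv := hasDerivAt_integral_ball (μH[2] : Measure E2) hF hcont (a := X₀) (ε := ε) hδ
        fun X hX s hs => by
          have hs' := hIco (hδT hs)
          exact hasDerivAt_sqrt_Gdet_mul hxh (hv.differentiable two_ne_zero)
            (hρ.differentiable one_ne_zero)
            (Filter.mem_of_superset (hUopen.mem_nhds (hεU hX)) fun Y hY => hflow Y hY s hs')
            (hNs X (hεU hX) s hs') (hpos X (hεU hX) s hs')
      refine hderiv.unique
        ((hmass _ Metric.isOpen_ball hεU t₀ ht₀).congr_of_eventuallyEq ?_)
      filter_upwards [isOpen_Ioo.mem_nhds ht₀] with s hs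
      exact (integral_image_eq_integral_sqrt_Gdet_mul hxh1 hρ.continuous measurableSet_ball
        ((hinj s (hIco hs)).mono hεU) fun X hX => hpos X (hεU hX) s (hIco hs)).symm)
  exact (mul_eq_zero.1 hzero).resolve_left (Real.sqrt_pos.2 (hpos X₀ hX₀ t₀ (hIco ht₀))).ne'
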